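/- At the uniform point η = π/8, λ = 5π/8, μ = 0 (so α = π/(π−2η) = 4/3), the NE branch of the arctic curve of the 20V model with DWBC3 lies on a real algebraic curve of degree 10: for every ξ ∈ (0, π/4), setting x = X_NE(ξ) + 3/2 and y = Y_NE(ξ) − 1/2, one has 2⁶·3¹¹·(x²+y²)⁵ − 2⁴·3⁹·67·(x²+y²)⁴ − 2²·3⁶·(x²+y²)²·(13·83·(x²+y²) + 2⁶·5³·√3·x·y) − 3²·17·9323·(x²+y²)² − 2¹⁰·3²·5⁵·x²·y² − 2⁶·3⁴·5²·11·√3·x·y·(x²+y²) − 2¹⁰·3·41·(x²+y²) − 2⁷·3·23·241·√3·x·y − 2¹⁰·13² = 0. -/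

import Mathlib

open Real

/-- The inverse slope `A(ξ) = s(ξ)⁻¹` of the family of tangent lines in the Tangent
Method for the 20V model with DWBC3. -/
noncomputable def A20V (η lam mu ξ : ℝ) : ℝ :=
  (sin (ξ + lam + η) * sin (ξ + lam - η) / (sin ξ * sin (ξ + 2 * η))) *
    ((sin ξ * sin (ξ + 2 * η) +
        sin (ξ + (lam - η + mu) / 2) * sin (ξ + (lam + 3 * η + mu) / 2)) /
      (sin (ξ + lam + η) * sin (ξ + lam - η) +
        sin (ξ + (lam - η + mu) / 2) * sin (ξ + (lam + 3 * η + mu) / 2)))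

/-- The saddle-point exit position `κ(ξ)` of the Tangent Method for the 20V model
with DWBC3, with `α = π/(π - 2η)`. -/
noncomputable def kappa20V (η lam mu ξ : ℝ) : ℝ :=
  (2 * cot (ξ + lam - η) - cot ξ - cot (ξ + lam + η) +
      (π / (π - 2 * η)) * cot ((π / (π - 2 * η)) * ξ) -
      (π / (π - 2 * η)) * cot ((π / (π - 2 * η)) * (ξ + lam - η))) *
    (sin (ξ + lam + η) * sin (ξ + lam - η) * sin (ξ + (lam - η + mu) / 2) *
      sin (ξ + (lam + 3 * η + mu) / 2)) /
    (sin (2 * η) *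
      (sin (ξ + lam + η) * sin (ξ + lam - η) +
        sin (ξ + (lam - η + mu) / 2) * sin (ξ + (lam + 3 * η + mu) / 2)))

/-- The `x`-coordinate of the NE branch of the arctic curve (envelope of the family
of tangent lines): `X_NE(ξ) = κ'(ξ)/A'(ξ)`. -/
noncomputable def Xne (η lam mu ξ : ℝ) : ℝ :=
  deriv (kappa20V η lam mu) ξ / deriv (A20V η lam mu) ξ

/-- The `y`-coordinate of the NE branch of the arctic curve:
`Y_NE(ξ) = κ(ξ) - A(ξ)·κ'(ξ)/A'(ξ)`. -/
noncomputable def Yne (η lam mu ξ : ℝ) : ℝ :=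
  kappa20V η lam mu ξ - A20V η lam mu ξ * Xne η lam mu ξ

lemma ne_sqrt3_sq : Real.sqrt 3 ^ 2 = 3 := Real.sq_sqrt (by norm_num)

lemma ne_cot_diff (t : ℝ) (hP : sin t ≠ 0) (hQ : sin (t + 2 * π / 3) ≠ 0) :
    sin (3 * t) * (cot t - cot (t + 2 * π / 3)) = 2 * Real.sqrt 3 * sin (t + π / 3) := by
  have h3 := ne_sqrt3_sq
  have e : t + 2 * π / 3 = t + π - π / 3 := by ring
  have hs : sin (t + 2 * π / 3) = - sin t / 2 + Real.sqrt 3 / 2 * cos t := by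
    rw [e, sin_sub, sin_add_pi, cos_add_pi, sin_pi_div_three, cos_pi_div_three]; ring
  have hc : cos (t + 2 * π / 3) = - cos t / 2 - Real.sqrt 3 / 2 * sin t := by
    rw [e, cos_sub, sin_add_pi, cos_add_pi, sin_pi_div_three, cos_pi_div_three]; ring
  rw [cot_eq_cos_div_sin, cot_eq_cos_div_sin]
  rw [hs] at hQ ⊢
  rw [hc, sin_three_mul, sin_add, sin_pi_div_three, cos_pi_div_three]
  have hsc := sin_sq_add_cos_sq t
  generalize sin t = P at *
  generalize cos t = Q at *
  generalize Real.sqrt 3 = r at *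
  have hd : Q / P - (- Q / 2 - r / 2 * P) / (- P / 2 + r / 2 * Q)
      = (r / 2) / (P * (- P / 2 + r / 2 * Q)) := by
    rw [div_sub_div _ _ hP hQ]
    congr 1
    linear_combination (r / 2) * hsc
  rw [hd]
  have hn : 3 * P - 4 * P ^ 3 = (P * (- P / 2 + r / 2 * Q)) * (2 * (r * Q + P)) := by
    linear_combination (-3 * P) * hsc - P * Q ^ 2 * h3
  rw [hn, mul_comm, ← mul_assoc, div_mul_cancel₀ _ (mul_ne_zero hP hQ)]
  ring

/-- The geometry at the uniform point. -/
lemma ne_A_eq (x : ℝ) (h0 : 0 < x) (h1 : x < π / 4) :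
    A20V (π / 8) (5 * π / 8) 0 x = cos (2 * x) / sin (2 * x) := by
  have hs : 0 < sin x := sin_pos_of_pos_of_lt_pi h0 (by linarith [pi_pos])
  have hc : 0 < cos x := cos_pos_of_mem_Ioo ⟨by linarith [pi_pos], by linarith [pi_pos]⟩
  have hr : (0:ℝ) < Real.sqrt 2 := by positivity
  unfold A20V
  rw [show x + 5 * π / 8 + π / 8 = x + π - π / 4 by ring,
    show x + 5 * π / 8 - π / 8 = x + π / 2 by ring,
    show x + 2 * (π / 8) = x + π / 4 by ring,
    show x + (5 * π / 8 - π / 8 + 0) / 2 = x + π / 4 by ring,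
    show x + (5 * π / 8 + 3 * (π / 8) + 0) / 2 = x + π / 2 by ring,
    sin_sub, sin_add_pi, cos_add_pi, sin_add_pi_div_two, sin_add, sin_pi_div_four,
    cos_pi_div_four, sin_two_mul, cos_two_mul']
  generalize sin x = s at *
  generalize cos x = c at *
  generalize Real.sqrt 2 = w at *
  have e1 : (-s * (w / 2) - -c * (w / 2)) * c + (s * (w / 2) + c * (w / 2)) * c = w * c ^ 2 := by
    ring
  have e2 : s * (s * (w / 2) + c * (w / 2)) + (s * (w / 2) + c * (w / 2)) * c
      = (w / 2) * (s + c) ^ 2 := by ring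
  have e3 : s * (s * (w / 2) + c * (w / 2)) = (w / 2) * (s * (s + c)) := by ring
  have e4 : (-s * (w / 2) - -c * (w / 2)) * c = (w / 2) * ((c - s) * c) := by ring
  rw [e1, e2, e3, e4]
  have : s + c ≠ 0 := by positivity
  field_simp
  try ring

lemma ne_kappa_eq (x : ℝ) (h0 : 0 < x) (h1 : x < π / 4) :
    kappa20V (π / 8) (5 * π / 8) 0 x =
      (-3 / 2 * cos (2 * x) + sin (2 * x) / 2 + 1 / 2
        + 2 / 3 * Real.sqrt 3 * sin (4 / 3 * x + π / 3)) / sin (2 * x) := by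
  have hs : 0 < sin x := sin_pos_of_pos_of_lt_pi h0 (by linarith [pi_pos])
  have hc : 0 < cos x := cos_pos_of_mem_Ioo ⟨by linarith [pi_pos], by linarith [pi_pos]⟩
  have hr : (0:ℝ) < Real.sqrt 2 := by positivity
  have hC : 0 < cos (2 * x) := cos_pos_of_mem_Ioo ⟨by linarith [pi_pos], by linarith [pi_pos]⟩
  have hk := ne_cot_diff (4 / 3 * x)
    (sin_pos_of_pos_of_lt_pi (by linarith) (by linarith [pi_pos])).ne'
    (sin_pos_of_pos_of_lt_pi (by linarith [pi_pos]) (by linarith [pi_pos])).ne'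
  have hsc := sin_sq_add_cos_sq x
  have hα : π / (π - 2 * (π / 8)) = 4 / 3 := by
    have := pi_pos.ne'
    rw [show π - 2 * (π / 8) = 3 / 4 * π by ring]
    field_simp
  unfold kappa20V
  rw [hα, show x + 5 * π / 8 + π / 8 = x + π - π / 4 by ring,
    show x + 5 * π / 8 - π / 8 = x + π / 2 by ring,
    show 2 * (π / 8) = π / 4 by ring,
    show x + (5 * π / 8 - π / 8 + 0) / 2 = x + π / 4 by ring,
    show x + (5 * π / 8 + 3 * (π / 8) + 0) / 2 = x + π / 2 by ring,
    show 4 / 3 * (x + π / 2) = 4 / 3 * x + 2 * π / 3 by ring]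
  rw [show 3 * (4 / 3 * x) = 2 * (2 * x) by ring, sin_two_mul] at hk
  have hk2 : 2 / 3 * Real.sqrt 3 * sin (4 / 3 * x + π / 3) = 2 / 3 * sin (2 * x) * cos (2 * x) *
      (cot (4 / 3 * x) - cot (4 / 3 * x + 2 * π / 3)) := by linear_combination (-1 / 3) * hk
  rw [hk2]
  rw [cot_eq_cos_div_sin (x + π / 2), cot_eq_cos_div_sin x, cot_eq_cos_div_sin (x + π - π / 4)]
  rw [sin_sub, cos_sub, sin_add_pi, cos_add_pi, sin_add_pi_div_two, cos_add_pi_div_two,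
    sin_add x, sin_pi_div_four, cos_pi_div_four]
  rw [cos_two_mul'] at hC ⊢
  rw [sin_two_mul]
  generalize cot (4 / 3 * x) = k1 at *
  generalize cot (4 / 3 * x + 2 * π / 3) = k2 at *
  have hw : Real.sqrt 2 ^ 2 = 2 := Real.sq_sqrt (by norm_num)
  clear hk hk2 h0 h1 hα
  generalize sin x = s at *
  generalize cos x = c at *
  generalize Real.sqrt 2 = w at *
  have hcs : c - s ≠ 0 := by
    intro h
    have : c = s := by linarith
    rw [this] at hC; simp at hC
  have e1 : (-s * (w / 2) - -c * (w / 2)) * c + (s * (w / 2) + c * (w / 2)) * c = w * c ^ 2 := by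
    ring
  have e2 : (-s * (w / 2) - -c * (w / 2)) * c * (s * (w / 2) + c * (w / 2)) * c
      = w ^ 2 / 4 * ((c ^ 2 - s ^ 2) * c ^ 2) := by ring
  have e3 : (-c * (w / 2) + -s * (w / 2)) / (-s * (w / 2) - -c * (w / 2)) = - (c + s) / (c - s) := by
    rw [show -c * (w / 2) + -s * (w / 2) = -(c + s) * (w / 2) by ring,
      show -s * (w / 2) - -c * (w / 2) = (c - s) * (w / 2) by ring]
    field_simp
  rw [e1, e2, e3]
  have e4 : ∀ B : ℝ, B * (w ^ 2 / 4 * ((c ^ 2 - s ^ 2) * c ^ 2)) / (w / 2 * (w * c ^ 2))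
      = B * (c ^ 2 - s ^ 2) / 2 := by
    intro B; field_simp; try ring
  rw [e4]
  have e5 : (2 * (-s / c) - c / s - -(c + s) / (c - s) + 4 / 3 * k1 - 4 / 3 * k2)
      * (c ^ 2 - s ^ 2) / 2 = ((-2 * s ^ 2 - c ^ 2) * (c ^ 2 - s ^ 2) + s * c * (c + s) ^ 2
        + 4 / 3 * (k1 - k2) * (s * c) * (c ^ 2 - s ^ 2)) / (2 * s * c) := by
    field_simp
    ring
  rw [e5]
  congr 1
  linear_combination (-3 / 2 * (c ^ 2 - s ^ 2) + s * c + 1 / 2 * (s ^ 2 + c ^ 2 + 1)) * hsc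

lemma ne_XY (x : ℝ) (h0 : 0 < x) (h1 : x < π / 4) :
    Xne (π / 8) (5 * π / 8) 0 x + 3 / 2 =
      cos (2 * x) * (1 / 2 + 2 / 3 * Real.sqrt 3 * sin (4 / 3 * x + π / 3))
        - sin (2 * x) * (4 / 9 * Real.sqrt 3 * cos (4 / 3 * x + π / 3)) ∧
    Yne (π / 8) (5 * π / 8) 0 x - 1 / 2 =
      sin (2 * x) * (1 / 2 + 2 / 3 * Real.sqrt 3 * sin (4 / 3 * x + π / 3))
        + cos (2 * x) * (4 / 9 * Real.sqrt 3 * cos (4 / 3 * x + π / 3)) := by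
  have hS : sin (2 * x) ≠ 0 :=
    (sin_pos_of_pos_of_lt_pi (by linarith) (by linarith [pi_pos])).ne'
  have hnhds : Set.Ioo 0 (π / 4) ∈ nhds x := Ioo_mem_nhds h0 h1
  have hA : A20V (π / 8) (5 * π / 8) 0 =ᶠ[nhds x] fun x => cos (2 * x) / sin (2 * x) := by
    filter_upwards [hnhds] with y hy using ne_A_eq y hy.1 hy.2
  have hK : kappa20V (π / 8) (5 * π / 8) 0 =ᶠ[nhds x] fun x =>
      (-3 / 2 * cos (2 * x) + sin (2 * x) / 2 + 1 / 2
        + 2 / 3 * Real.sqrt 3 * sin (4 / 3 * x + π / 3)) / sin (2 * x) := by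
    filter_upwards [hnhds] with y hy using ne_kappa_eq y hy.1 hy.2
  have d2 : HasDerivAt (fun x : ℝ => 2 * x) 2 x := by
    simpa using (hasDerivAt_id x).const_mul (2:ℝ)
  have d4 : HasDerivAt (fun x : ℝ => 4 / 3 * x + π / 3) (4 / 3) x := by
    simpa using ((hasDerivAt_id x).const_mul (4 / 3 : ℝ)).add_const (π / 3)
  have dA := d2.cos.fun_div d2.sin hS
  have dK := (((((d2.cos.const_mul (-3 / 2 : ℝ)).fun_add (d2.sin.div_const 2)).add_const
    (1 / 2 : ℝ)).fun_add (d4.sin.const_mul (2 / 3 * Real.sqrt 3))).fun_div d2.sin hS)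
  have hsc := sin_sq_add_cos_sq (2 * x)
  have hX : Xne (π / 8) (5 * π / 8) 0 x =
      cos (2 * x) * (1 / 2 + 2 / 3 * Real.sqrt 3 * sin (4 / 3 * x + π / 3))
        - sin (2 * x) * (4 / 9 * Real.sqrt 3 * cos (4 / 3 * x + π / 3)) - 3 / 2 := by
    unfold Xne
    rw [hA.deriv_eq, hK.deriv_eq, dA.deriv, dK.deriv]
    have : (-sin (2 * x) * 2 * sin (2 * x) - cos (2 * x) * (cos (2 * x) * 2)) = -2 := by
      linear_combination (-2) * hsc
    rw [this, div_div_div_cancel_right₀ (pow_ne_zero 2 hS)]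
    linear_combination (-3 / 2) * hsc
  refine ⟨by rw [hX]; ring, ?_⟩
  unfold Yne
  rw [hX, ne_A_eq x h0 h1, ne_kappa_eq x h0 h1, div_mul_eq_mul_div (cos (2 * x)), ← sub_div,
    sub_eq_iff_eq_add, div_eq_iff hS]
  linear_combination (-(1 / 2 + 2 / 3 * Real.sqrt 3 * sin (4 / 3 * x + π / 3))) * hsc

lemma ne_poly (X Y r m R T : ℝ) (hr : r ^ 2 = 3)
    (hR : X ^ 2 + Y ^ 2 = R) (hT : r * X * Y = T)
    (hR' : R = 1 / 4 + 2 * m + 4 * m ^ 2 + 16 / 27 * (1 - 3 * m ^ 2))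
    (hT' : T = -((1 / 2 + 2 * m) ^ 2 - 16 / 27 * (1 - 3 * m ^ 2)) * (9 * m - 36 * m ^ 3) / 2
      - (1 / 2 + 2 * m) * (4 / 3) * (1 - 3 * m ^ 2) * (1 - 12 * m ^ 2)) :
    2 ^ 6 * 3 ^ 11 * (X ^ 2 + Y ^ 2) ^ 5 - 2 ^ 4 * 3 ^ 9 * 67 * (X ^ 2 + Y ^ 2) ^ 4 -
      2 ^ 2 * 3 ^ 6 * (X ^ 2 + Y ^ 2) ^ 2 *
        (13 * 83 * (X ^ 2 + Y ^ 2) + 2 ^ 6 * 5 ^ 3 * r * X * Y) -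
      3 ^ 2 * 17 * 9323 * (X ^ 2 + Y ^ 2) ^ 2 -
      2 ^ 10 * 3 ^ 2 * 5 ^ 5 * X ^ 2 * Y ^ 2 -
      2 ^ 6 * 3 ^ 4 * 5 ^ 2 * 11 * r * X * Y * (X ^ 2 + Y ^ 2) -
      2 ^ 10 * 3 * 41 * (X ^ 2 + Y ^ 2) -
      2 ^ 7 * 3 * 23 * 241 * r * X * Y -
      2 ^ 10 * 13 ^ 2 = 0 := by
  have h2 : X ^ 2 * Y ^ 2 = T ^ 2 / 3 := by
    rw [← hT]; linear_combination (-(X ^ 2 * Y ^ 2) / 3) * hr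
  have key : 2 ^ 6 * 3 ^ 11 * R ^ 5 - 2 ^ 4 * 3 ^ 9 * 67 * R ^ 4 -
      2 ^ 2 * 3 ^ 6 * R ^ 2 * (13 * 83 * R + 2 ^ 6 * 5 ^ 3 * T) -
      3 ^ 2 * 17 * 9323 * R ^ 2 - 2 ^ 10 * 3 ^ 2 * 5 ^ 5 * (T ^ 2 / 3) -
      2 ^ 6 * 3 ^ 4 * 5 ^ 2 * 11 * T * R - 2 ^ 10 * 3 * 41 * R -
      2 ^ 7 * 3 * 23 * 241 * T - 2 ^ 10 * 13 ^ 2 = 0 := by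
    rw [hR', hT']; ring
  rw [hR]
  linear_combination key - 2 ^ 10 * 3 ^ 2 * 5 ^ 5 * h2 - (2 ^ 2 * 3 ^ 6 * R ^ 2 * 2 ^ 6 * 5 ^ 3
    + 2 ^ 6 * 3 ^ 4 * 5 ^ 2 * 11 * R + 2 ^ 7 * 3 * 23 * 241) * hT

/-- At the uniform point `η = π/8`, `λ = 5π/8`, `μ = 0`, the NE
branch of the arctic curve of the 20V model with DWBC3 lies on a real algebraic
curve of degree 10, written in the shifted coordinates `x = X_NE + 3/2`,
`y = Y_NE - 1/2`. -/
theorem NE_branch_algebraic (ξ : ℝ) (h0 : 0 < ξ) (h1 : ξ < π / 4) :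
    2 ^ 6 * 3 ^ 11 * ((Xne (π / 8) (5 * π / 8) 0 ξ + 3 / 2) ^ 2 +
          (Yne (π / 8) (5 * π / 8) 0 ξ - 1 / 2) ^ 2) ^ 5 -
      2 ^ 4 * 3 ^ 9 * 67 * ((Xne (π / 8) (5 * π / 8) 0 ξ + 3 / 2) ^ 2 +
          (Yne (π / 8) (5 * π / 8) 0 ξ - 1 / 2) ^ 2) ^ 4 -
      2 ^ 2 * 3 ^ 6 * ((Xne (π / 8) (5 * π / 8) 0 ξ + 3 / 2) ^ 2 +
          (Yne (π / 8) (5 * π / 8) 0 ξ - 1 / 2) ^ 2) ^ 2 *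
        (13 * 83 * ((Xne (π / 8) (5 * π / 8) 0 ξ + 3 / 2) ^ 2 +
            (Yne (π / 8) (5 * π / 8) 0 ξ - 1 / 2) ^ 2) +
          2 ^ 6 * 5 ^ 3 * Real.sqrt 3 * (Xne (π / 8) (5 * π / 8) 0 ξ + 3 / 2) *
            (Yne (π / 8) (5 * π / 8) 0 ξ - 1 / 2)) -
      3 ^ 2 * 17 * 9323 * ((Xne (π / 8) (5 * π / 8) 0 ξ + 3 / 2) ^ 2 +
          (Yne (π / 8) (5 * π / 8) 0 ξ - 1 / 2) ^ 2) ^ 2 -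
      2 ^ 10 * 3 ^ 2 * 5 ^ 5 * (Xne (π / 8) (5 * π / 8) 0 ξ + 3 / 2) ^ 2 *
        (Yne (π / 8) (5 * π / 8) 0 ξ - 1 / 2) ^ 2 -
      2 ^ 6 * 3 ^ 4 * 5 ^ 2 * 11 * Real.sqrt 3 * (Xne (π / 8) (5 * π / 8) 0 ξ + 3 / 2) *
        (Yne (π / 8) (5 * π / 8) 0 ξ - 1 / 2) *
        ((Xne (π / 8) (5 * π / 8) 0 ξ + 3 / 2) ^ 2 +
          (Yne (π / 8) (5 * π / 8) 0 ξ - 1 / 2) ^ 2) -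
      2 ^ 10 * 3 * 41 * ((Xne (π / 8) (5 * π / 8) 0 ξ + 3 / 2) ^ 2 +
          (Yne (π / 8) (5 * π / 8) 0 ξ - 1 / 2) ^ 2) -
      2 ^ 7 * 3 * 23 * 241 * Real.sqrt 3 * (Xne (π / 8) (5 * π / 8) 0 ξ + 3 / 2) *
        (Yne (π / 8) (5 * π / 8) 0 ξ - 1 / 2) -
      2 ^ 10 * 13 ^ 2 = 0 := by
  obtain ⟨hX, hY⟩ := ne_XY ξ h0 h1
  have hr := ne_sqrt3_sq
  have hu := sin_sq_add_cos_sq (4 / 3 * ξ + π / 3)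
  have hv := sin_sq_add_cos_sq (2 * ξ)
  have e : 2 * (2 * ξ) = 3 * (4 / 3 * ξ + π / 3) - π := by ring
  have hs2 : 2 * sin (2 * ξ) * cos (2 * ξ) = -(3 * sin (4 / 3 * ξ + π / 3)
      - 4 * sin (4 / 3 * ξ + π / 3) ^ 3) := by
    rw [← sin_two_mul, e, sin_sub_pi, sin_three_mul]
  have hc2 : cos (2 * ξ) ^ 2 - sin (2 * ξ) ^ 2 = -(4 * cos (4 / 3 * ξ + π / 3) ^ 3
      - 3 * cos (4 / 3 * ξ + π / 3)) := by
    rw [← cos_two_mul', e, cos_sub_pi, cos_three_mul]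
  refine ne_poly _ _ (Real.sqrt 3) (Real.sqrt 3 * sin (4 / 3 * ξ + π / 3) / 3) _ _ hr rfl rfl ?_ ?_
  · rw [hX, hY]
    generalize Real.sqrt 3 = r at *
    generalize sin (4 / 3 * ξ + π / 3) = p at *
    generalize cos (4 / 3 * ξ + π / 3) = q at *
    generalize sin (2 * ξ) = S at *
    generalize cos (2 * ξ) = C at *
    have hq : q ^ 2 = 1 - p ^ 2 := by linarith
    linear_combination ((1 / 2 + 2 / 3 * r * p) ^ 2 + (4 / 9 * r * q) ^ 2) * hv
      + (16 / 81 * r ^ 2) * hq + (16 / 81) * hr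
  · rw [hX, hY]
    generalize Real.sqrt 3 = r at *
    generalize sin (4 / 3 * ξ + π / 3) = p at *
    generalize cos (4 / 3 * ξ + π / 3) = q at *
    generalize sin (2 * ξ) = S at *
    generalize cos (2 * ξ) = C at *
    have hq : q ^ 2 = 1 - p ^ 2 := by linarith
    have hq4 : q * (4 * q ^ 3 - 3 * q) = (1 - p ^ 2) * (1 - 4 * p ^ 2) := by
      linear_combination (4 * q ^ 2 + 1 - 4 * p ^ 2) * hq
    have h1' : r * (C * (1 / 2 + 2 / 3 * r * p) - S * (4 / 9 * r * q)) *
        (S * (1 / 2 + 2 / 3 * r * p) + C * (4 / 9 * r * q)) =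
        -((1 / 2 + 2 / 3 * r * p) ^ 2 - 16 / 81 * r ^ 2 * (1 - p ^ 2)) * (r * (3 * p - 4 * p ^ 3)) / 2
        - (1 / 2 + 2 / 3 * r * p) * (4 / 9 * r ^ 2) * ((1 - p ^ 2) * (1 - 4 * p ^ 2)) := by
      linear_combination (r / 2 * ((1 / 2 + 2 / 3 * r * p) ^ 2 - (4 / 9 * r * q) ^ 2)) * hs2
        + ((1 / 2 + 2 / 3 * r * p) * (4 / 9 * r ^ 2 * q)) * hc2
        - ((1 / 2 + 2 / 3 * r * p) * (4 / 9 * r ^ 2)) * hq4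
        + (8 / 81 * r ^ 3 * (3 * p - 4 * p ^ 3)) * hq
    rw [h1']
    have hp : p = r * (r * p / 3) := by linear_combination (-p / 3) * hr
    have a1 : 1 - p ^ 2 = 1 - 3 * (r * p / 3) ^ 2 := by linear_combination (p ^ 2 / 3) * hr
    have a2 : 1 - 4 * p ^ 2 = 1 - 12 * (r * p / 3) ^ 2 := by
      linear_combination (4 * p ^ 2 / 3) * hr
    have a3 : r * (3 * p - 4 * p ^ 3) = 9 * (r * p / 3) - 36 * (r * p / 3) ^ 3 := by
      linear_combination (4 * r * p ^ 3 / 3) * hr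
    rw [a1, a2, a3, hr]
    ring
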